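/- arXiv:2107.11854 — 2 statements merged into one kernel-verified Lean document; each statement's English description precedes it below -/
import Mathlib

section
/- Let 0 < p₀, q₀, p, q < ∞ and let f, g be measurable functions on (0,∞) satisfying condition (D). Assume that either (a) q > q₀ and q/p = q₀/p₀, or (b) q = q₀ and p > p₀. Assume moreover that ∫₀^∞ (f*(t)^{q₀} − g*(t)^{q₀}) d(t^{q₀/p₀}) ≥ 0 and that the function t ↦ (f*(t)^{q} − g*(t)^{q}) t^{q/p−1} belongs to L¹(0,∞). Then ∫₀^∞ (f*(t)^{q} − g*(t)^{q}) d(t^{q/p}) ≥ 0; in particular, if f, g ∈ L(p,q), then ‖g‖_{L(p,q)} ≤ ‖f‖_{L(p,q)}. -/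
open MeasureTheory Set Real Filter
open scoped ENNReal NNReal

/-- The distribution function `λ_f(τ) = |{t > 0 : |f t| > τ}|` of a function on `(0,∞)`
with respect to Lebesgue measure. -/
noncomputable def distribFn (f : ℝ → ℝ) (τ : ℝ) : ℝ≥0∞ :=
  (volume.restrict (Set.Ioi (0:ℝ))) {t : ℝ | τ < |f t|}

/-- The non-increasing rearrangement `f*(s) = inf{τ > 0 : λ_f(τ) ≤ s}`. -/
noncomputable def rearr (f : ℝ → ℝ) (s : ℝ) : ℝ :=
  sInf {τ : ℝ | 0 < τ ∧ distribFn f τ ≤ ENNReal.ofReal s}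

/-- Condition (D): there is `τ₀ ∈ (0,∞)` such that `λ_f(τ) ≤ λ_g(τ)` for `τ < τ₀` and
`λ_f(τ) ≥ λ_g(τ)` for `τ > τ₀`. -/
def CondD (f g : ℝ → ℝ) : Prop :=
  ∃ τ₀ : ℝ, 0 < τ₀ ∧ (∀ τ : ℝ, 0 < τ → τ < τ₀ → distribFn f τ ≤ distribFn g τ) ∧
    (∀ τ : ℝ, τ₀ < τ → distribFn g τ ≤ distribFn f τ)

lemma distribFn_antitone (f : ℝ → ℝ) : Antitone (distribFn f) := fun _ _ hab =>
  measure_mono fun _ ht => lt_of_le_of_lt hab ht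

lemma rearr_nonneg (f : ℝ → ℝ) (s : ℝ) : 0 ≤ rearr f s :=
  Real.sInf_nonneg fun _ hτ => hτ.1.le

lemma rearr_le {f : ℝ → ℝ} {s τ : ℝ} (hτ : 0 < τ) (h : distribFn f τ ≤ ENNReal.ofReal s) :
    rearr f s ≤ τ :=
  csInf_le ⟨0, fun _ hx => hx.1.le⟩ ⟨hτ, h⟩

lemma distribFn_le_of_rearr_lt {f : ℝ → ℝ} {s τ : ℝ}
    (hne : ∃ σ, 0 < σ ∧ distribFn f σ ≤ ENNReal.ofReal s) (h : rearr f s < τ) :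
    distribFn f τ ≤ ENNReal.ofReal s := by
  obtain ⟨σ, hσ, hστ⟩ := exists_lt_of_csInf_lt hne h
  exact (distribFn_antitone f hστ.le).trans hσ.2

lemma rearr_anti {f : ℝ → ℝ} {s t : ℝ} (hst : s ≤ t)
    (hne : ∃ σ, 0 < σ ∧ distribFn f σ ≤ ENNReal.ofReal s) : rearr f t ≤ rearr f s :=
  csInf_le_csInf ⟨0, fun _ hx => hx.1.le⟩ hne
    fun _ hx => ⟨hx.1, hx.2.trans (ENNReal.ofReal_le_ofReal hst)⟩

/-- Either `f` has a genuine (finite) rearrangement, or its distribution function is identically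
infinite and the infimum defining `rearr f` is taken over the empty set. -/
lemma exists_distribFn_le_or_rearr_eq_zero {f : ℝ → ℝ} (hf : Measurable f) :
    (∀ s, 0 < s → ∃ σ, 0 < σ ∧ distribFn f σ ≤ ENNReal.ofReal s) ∨ ∀ s, rearr f s = 0 := by
  by_cases h : ∃ τ, distribFn f τ ≠ ∞
  · left
    intro s hs
    have hlim : Tendsto (distribFn f) atTop (nhds 0) := by
      have := tendsto_measure_iInter_atTop (μ := volume.restrict (Set.Ioi (0:ℝ)))
        (s := fun τ : ℝ => {t : ℝ | τ < |f t|})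
        (fun τ => (measurableSet_lt measurable_const hf.abs).nullMeasurableSet)
        (fun _ _ hab _ ht => lt_of_le_of_lt hab ht) h
      have he : (⋂ τ : ℝ, {t : ℝ | τ < |f t|}) = ∅ := by
        ext t
        simp only [Set.mem_iInter, Set.mem_ofPred_eq, Set.mem_empty_iff_false, iff_false]
        exact fun H => lt_irrefl _ (H |f t|)
      rw [he, measure_empty] at this
      exact this
    obtain ⟨σ, hσ, hσ0⟩ := ((hlim.eventually_le_const (ENNReal.ofReal_pos.2 hs)).and
      (eventually_gt_atTop 0)).exists
    exact ⟨σ, hσ0, hσ⟩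
  · right
    push Not at h
    intro s
    have : {τ : ℝ | 0 < τ ∧ distribFn f τ ≤ ENNReal.ofReal s} = ∅ := by
      ext τ
      simp [h τ]
    rw [rearr, this, Real.sInf_empty]

/-- Condition (D) read off the rearrangements. -/
lemma exists_rearr_separation {f g : ℝ → ℝ} (hD : CondD f g)
    (hne : ∀ s, 0 < s → ∃ σ, 0 < σ ∧ distribFn f σ ≤ ENNReal.ofReal s) :
    ∃ τ₀, 0 < τ₀ ∧ ∀ s, 0 < s → (τ₀ ≤ rearr g s ∧ rearr g s ≤ rearr f s) ∨
      (rearr f s ≤ rearr g s ∧ rearr g s ≤ τ₀) ∨ rearr g s = τ₀ := by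
  obtain ⟨τ₀, h0, hlt, hgt⟩ := hD
  refine ⟨τ₀, h0, fun s hs => ?_⟩
  have hneg : ∃ σ, 0 < σ ∧ distribFn g σ ≤ ENNReal.ofReal s := by
    obtain ⟨σ, hσ, h⟩ := hne s hs
    have h1 : τ₀ < max σ (τ₀ + 1) := lt_max_of_lt_right (by linarith)
    exact ⟨max σ (τ₀ + 1), h0.trans h1,
      (hgt _ h1).trans ((distribFn_antitone f (le_max_left _ _)).trans h)⟩
  rcases lt_trichotomy (rearr g s) τ₀ with h | h | h
  · refine Or.inr (Or.inl ⟨le_of_forall_gt_imp_ge_of_dense fun τ hτ => ?_, h.le⟩)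
    obtain ⟨τ', h1, h2⟩ := exists_between (lt_min hτ h)
    have h3 : 0 < τ' := (rearr_nonneg g s).trans_lt h1
    exact (rearr_le h3 ((hlt τ' h3 (h2.trans_le (min_le_right _ _))).trans
      (distribFn_le_of_rearr_lt hneg h1))).trans (h2.le.trans (min_le_left _ _))
  · exact Or.inr (Or.inr h)
  · refine Or.inl ⟨h.le, ?_⟩
    by_contra! hlt'
    obtain ⟨τ, h1, h2⟩ := exists_between (max_lt h hlt')
    have h3 : τ₀ < τ := (le_max_left _ _).trans_lt h1
    exact (rearr_le (h0.trans h3) ((hgt τ h3).trans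
      (distribFn_le_of_rearr_lt (hne s hs) ((le_max_right _ _).trans_lt h1)))).not_gt h2

/-- Tangent line inequality for the convex function `x ↦ x ^ r`. -/
lemma mul_rpow_sub_one_mul_sub_le {x y r : ℝ} (hx : 0 ≤ x) (hy : 0 < y) (hr : 1 ≤ r) :
    r * y ^ (r - 1) * (x - y) ≤ x ^ r - y ^ r := by
  have h := one_add_mul_self_le_rpow_one_add (s := x / y - 1)
    (by linarith [div_nonneg hx hy.le]) hr
  rw [add_sub_cancel, Real.div_rpow hx hy.le, le_div_iff₀ (Real.rpow_pos_of_pos hy r)] at h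
  rw [Real.rpow_sub_one hy.ne']
  have : (1 + r * (x / y - 1)) * y ^ r = y ^ r + r * (y ^ r / y) * (x - y) := by
    field_simp
  linarith

lemma mul_rpow_sub_le_rpow_sub {a b τ q₀ q : ℝ} (ha : 0 ≤ a) (hb : 0 ≤ b) (hτ : 0 < τ)
    (hq₀ : 0 < q₀) (hq : q₀ < q)
    (h : (τ ≤ b ∧ b ≤ a) ∨ (a ≤ b ∧ b ≤ τ) ∨ b = τ) :
    q / q₀ * (τ ^ q₀) ^ (q / q₀ - 1) * (a ^ q₀ - b ^ q₀) ≤ a ^ q - b ^ q := by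
  have hr : 1 ≤ q / q₀ := (one_le_div hq₀).2 hq.le
  have hr0 : 0 ≤ q / q₀ - 1 := by linarith
  have e : ∀ x : ℝ, 0 ≤ x → x ^ q = (x ^ q₀) ^ (q / q₀) := fun x hx => by
    rw [← Real.rpow_mul hx, mul_div_cancel₀ _ hq₀.ne']
  have hA : 0 ≤ a ^ q₀ := Real.rpow_nonneg ha _
  have hT : 0 < τ ^ q₀ := Real.rpow_pos_of_pos hτ _
  rw [e a ha, e b hb]
  rcases hb.eq_or_lt with rfl | hb'
  · have ha0 : a = 0 := by
      rcases h with h | h | h <;> linarith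
    subst ha0
    simp
  refine le_trans ?_ (mul_rpow_sub_one_mul_sub_le hA (Real.rpow_pos_of_pos hb' q₀) hr)
  rw [mul_assoc, mul_assoc]
  refine mul_le_mul_of_nonneg_left ?_ (by linarith)
  rcases h with ⟨h1, h2⟩ | ⟨h1, h2⟩ | rfl
  · exact mul_le_mul_of_nonneg_right (Real.rpow_le_rpow hT.le
      (Real.rpow_le_rpow hτ.le h1 hq₀.le) hr0) (sub_nonneg.2 (Real.rpow_le_rpow hb h2 hq₀.le))
  · exact mul_le_mul_of_nonpos_right (Real.rpow_le_rpow (Real.rpow_nonneg hb _)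
      (Real.rpow_le_rpow hb h2 hq₀.le) hr0) (sub_nonpos.2 (Real.rpow_le_rpow ha h1 hq₀.le))
  · exact le_rfl

/-- If `F ≤ G` and the weighted integral of `F ^ q₀ - G ^ q₀` is nonnegative, then `F = G` a.e.,
so that every other such integral vanishes. -/
lemma setIntegral_rpow_sub_eq_zero {F G : ℝ → ℝ} {q₀ q α β : ℝ} (hq₀ : 0 < q₀)
    (hF : ∀ t, 0 ≤ F t) (hFG : ∀ t, 0 < t → F t ≤ G t)
    (hint : IntegrableOn (fun t => (F t ^ q₀ - G t ^ q₀) * t ^ α) (Set.Ioi 0))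
    (hpos : 0 ≤ ∫ t in Set.Ioi (0:ℝ), (F t ^ q₀ - G t ^ q₀) * t ^ α) :
    ∫ t in Set.Ioi (0:ℝ), (F t ^ q - G t ^ q) * t ^ β = 0 := by
  have hle : ∀ t ∈ Set.Ioi (0:ℝ), (F t ^ q₀ - G t ^ q₀) * t ^ α ≤ 0 := fun t ht =>
    mul_nonpos_of_nonpos_of_nonneg
      (sub_nonpos.2 (Real.rpow_le_rpow (hF t) (hFG t ht) hq₀.le)) (Real.rpow_nonneg (le_of_lt ht) _)
  have h0 : ∫ t in Set.Ioi (0:ℝ), -((F t ^ q₀ - G t ^ q₀) * t ^ α) = 0 := by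
    rw [integral_neg, neg_eq_zero]
    exact le_antisymm (setIntegral_nonpos measurableSet_Ioi hle) hpos
  rw [setIntegral_eq_zero_iff_of_nonneg_ae
    ((ae_restrict_mem measurableSet_Ioi).mono fun t ht => neg_nonneg.2 (hle t ht)) hint.neg] at h0
  refine integral_eq_zero_of_ae ?_
  filter_upwards [h0, ae_restrict_mem measurableSet_Ioi] with t ht ht0
  have h1 := Real.rpow_pos_of_pos (show (0:ℝ) < t from ht0) α
  have h2 : F t ^ q₀ = G t ^ q₀ := by
    simpa [h1.ne', sub_eq_zero] using ht
  rw [(Real.rpow_left_inj (hF t) ((hF t).trans (hFG t ht0)) hq₀.ne').1 h2]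
  simp

/-- A function changing sign once from `+` to `-`, with nonnegative integral against `t ^ α`, has
nonnegative integral against `t ^ β` for `β ≤ α`. -/
lemma setIntegral_mul_rpow_nonneg_of_sign_change {h : ℝ → ℝ} {s₀ α β : ℝ} (hs₀ : 0 < s₀)
    (hβα : β ≤ α) (hl : ∀ t, 0 < t → t < s₀ → 0 ≤ h t) (hr : ∀ t, s₀ < t → h t ≤ 0)
    (hint₀ : IntegrableOn (fun t => h t * t ^ α) (Set.Ioi 0))
    (hpos : 0 ≤ ∫ t in Set.Ioi (0:ℝ), h t * t ^ α)
    (hint : IntegrableOn (fun t => h t * t ^ β) (Set.Ioi 0)) :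
    0 ≤ ∫ t in Set.Ioi (0:ℝ), h t * t ^ β := by
  calc 0 ≤ s₀ ^ (β - α) * ∫ t in Set.Ioi (0:ℝ), h t * t ^ α :=
        mul_nonneg (Real.rpow_nonneg hs₀.le _) hpos
    _ = ∫ t in Set.Ioi (0:ℝ), s₀ ^ (β - α) * (h t * t ^ α) := (integral_const_mul _ _).symm
    _ ≤ _ := by
      refine setIntegral_mono_on (hint₀.const_mul _) hint measurableSet_Ioi fun t ht => ?_
      have ht : 0 < t := ht
      have e : t ^ β = t ^ (β - α) * t ^ α := by
        rw [← Real.rpow_add ht, sub_add_cancel]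
      have hα := Real.rpow_nonneg ht.le α
      rw [e, ← mul_assoc, ← mul_assoc, mul_comm _ (h t)]
      refine mul_le_mul_of_nonneg_right ?_ hα
      rcases lt_trichotomy t s₀ with hts | rfl | hts
      · exact mul_le_mul_of_nonneg_left
          (Real.rpow_le_rpow_of_nonpos ht hts.le (by linarith)) (hl t ht hts)
      · exact le_rfl
      · exact mul_le_mul_of_nonpos_left
          (Real.rpow_le_rpow_of_nonpos hs₀ hts.le (by linarith)) (hr t hts)

lemma setIntegral_rearr_sub_nonneg {p₀ q₀ p q : ℝ} (hp₀ : 0 < p₀) (hq₀ : 0 < q₀)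
    {f g : ℝ → ℝ} (hf : Measurable f) (hD : CondD f g)
    (hab : (q₀ < q ∧ q / p = q₀ / p₀) ∨ (q = q₀ ∧ p₀ < p))
    (hint₀ : IntegrableOn
      (fun t => (rearr f t ^ q₀ - rearr g t ^ q₀) * t ^ (q₀ / p₀ - 1)) (Set.Ioi 0))
    (hpos₀ : 0 ≤ ∫ t in Set.Ioi (0:ℝ), (rearr f t ^ q₀ - rearr g t ^ q₀) * t ^ (q₀ / p₀ - 1))
    (hint : IntegrableOn
      (fun t => (rearr f t ^ q - rearr g t ^ q) * t ^ (q / p - 1)) (Set.Ioi 0)) :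
    0 ≤ ∫ t in Set.Ioi (0:ℝ), (rearr f t ^ q - rearr g t ^ q) * t ^ (q / p - 1) := by
  by_cases hle : ∀ t, 0 < t → rearr f t ≤ rearr g t
  · exact (setIntegral_rpow_sub_eq_zero hq₀ (rearr_nonneg f) hle hint₀ hpos₀).ge
  rcases exists_distribFn_le_or_rearr_eq_zero hf with hne | hz
  swap
  · exact (hle fun t _ => (hz t).trans_le (rearr_nonneg g t)).elim
  obtain ⟨τ₀, hτ₀, hsep⟩ := exists_rearr_separation hD hne
  rcases hab with ⟨hqq, hE⟩ | ⟨rfl, hpp⟩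
  · rw [hE] at hint ⊢
    set c := q / q₀ * (τ₀ ^ q₀) ^ (q / q₀ - 1)
    have hc : 0 ≤ c := mul_nonneg (div_nonneg (hq₀.trans hqq).le hq₀.le)
      (Real.rpow_nonneg (Real.rpow_nonneg hτ₀.le _) _)
    refine (mul_nonneg hc hpos₀).trans ?_
    rw [← integral_const_mul]
    refine setIntegral_mono_on (hint₀.const_mul _) hint measurableSet_Ioi fun t ht => ?_
    rw [← mul_assoc]
    exact mul_le_mul_of_nonneg_right (mul_rpow_sub_le_rpow_sub (rearr_nonneg f t)
      (rearr_nonneg g t) hτ₀ hq₀ hqq (hsep t ht)) (Real.rpow_nonneg (le_of_lt ht) _)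
  · have key : ∀ s t, 0 < s → s < t → rearr g t < rearr f t → rearr g s ≤ rearr f s := by
      intro s t hs hst hlt
      have h1 := rearr_anti hst.le (hne s hs)
      rcases hsep t (hs.trans hst) with h | h | h <;> rcases hsep s hs with h' | h' | h' <;>
        linarith
    have hsign : ∀ t, rearr g t ≤ rearr f t → 0 ≤ rearr f t ^ q - rearr g t ^ q := fun t h =>
      sub_nonneg.2 (Real.rpow_le_rpow (rearr_nonneg g t) h hq₀.le)
    by_cases hbdd : BddAbove {t | 0 < t ∧ rearr g t < rearr f t}
    · push Not at hle
      obtain ⟨t₁, ht₁, hlt₁⟩ := hle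
      have hnonempty : {t | 0 < t ∧ rearr g t < rearr f t}.Nonempty := ⟨t₁, ht₁, hlt₁⟩
      refine setIntegral_mul_rpow_nonneg_of_sign_change
        (s₀ := sSup {t | 0 < t ∧ rearr g t < rearr f t})
        (ht₁.trans_le (le_csSup hbdd ⟨ht₁, hlt₁⟩)) ?_ ?_ ?_ hint₀ hpos₀ hint
      · linarith [div_le_div_of_nonneg_left hq₀.le hp₀ hpp.le]
      · intro t ht hts
        obtain ⟨u, hu, htu⟩ := exists_lt_of_lt_csSup hnonempty hts
        exact hsign t (key t u ht htu hu.2)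
      · intro t hts
        have ht : 0 < t := (ht₁.trans_le (le_csSup hbdd ⟨ht₁, hlt₁⟩)).trans hts
        refine sub_nonpos.2 (Real.rpow_le_rpow (rearr_nonneg f t) ?_ hq₀.le)
        by_contra! hcon
        exact (le_csSup hbdd ⟨ht, hcon⟩).not_gt hts
    · refine setIntegral_nonneg measurableSet_Ioi fun t ht => ?_
      obtain ⟨u, hu, htu⟩ := not_bddAbove_iff.1 hbdd t
      exact mul_nonneg (hsign t (key t u ht htu hu.2)) (Real.rpow_nonneg (le_of_lt ht) _)

/-- Nazarov–Podkorytov type result for Lorentz `L(p,q)` spaces (sufficient conditions,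
cases (a) `q > q₀`, `q/p = q₀/p₀` and (b) `q = q₀`, `p > p₀`). Here
`∫₀^∞ h(t) d(t^β) = β ∫₀^∞ h(t) t^{β−1} dt` and
`‖f‖_{L(p,q)} = ((q/p) ∫₀^∞ f*(s)^q s^{q/p−1} ds)^{1/q}`. -/
theorem statement1 (p₀ q₀ p q : ℝ) (hp₀ : 0 < p₀) (hq₀ : 0 < q₀) (hp : 0 < p) (hq : 0 < q)
    (f g : ℝ → ℝ) (hf : Measurable f) (hg : Measurable g)
    (hD : CondD f g)
    (hab : (q₀ < q ∧ q / p = q₀ / p₀) ∨ (q = q₀ ∧ p₀ < p))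
    (hint₀ : IntegrableOn
      (fun t => (rearr f t ^ q₀ - rearr g t ^ q₀) * t ^ (q₀ / p₀ - 1)) (Set.Ioi 0))
    (hpos₀ : 0 ≤ (q₀ / p₀) *
      ∫ t in Set.Ioi (0:ℝ), (rearr f t ^ q₀ - rearr g t ^ q₀) * t ^ (q₀ / p₀ - 1))
    (hint : IntegrableOn
      (fun t => (rearr f t ^ q - rearr g t ^ q) * t ^ (q / p - 1)) (Set.Ioi 0)) :
    0 ≤ (q / p) * ∫ t in Set.Ioi (0:ℝ), (rearr f t ^ q - rearr g t ^ q) * t ^ (q / p - 1) ∧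
    (IntegrableOn (fun s => rearr f s ^ q * s ^ (q / p - 1)) (Set.Ioi 0) →
     IntegrableOn (fun s => rearr g s ^ q * s ^ (q / p - 1)) (Set.Ioi 0) →
     ((q / p) * ∫ s in Set.Ioi (0:ℝ), rearr g s ^ q * s ^ (q / p - 1)) ^ (1 / q) ≤
       ((q / p) * ∫ s in Set.Ioi (0:ℝ), rearr f s ^ q * s ^ (q / p - 1)) ^ (1 / q)) := by
  have hmain := setIntegral_rearr_sub_nonneg hp₀ hq₀ hf hD hab hint₀
    (nonneg_of_mul_nonneg_right hpos₀ (div_pos hq₀ hp₀)) hint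
  have hqp : 0 ≤ q / p := (div_pos hq hp).le
  refine ⟨mul_nonneg hqp hmain, fun hF hG => ?_⟩
  simp only [sub_mul] at hmain
  rw [integral_sub hF hG, sub_nonneg] at hmain
  refine Real.rpow_le_rpow (mul_nonneg hqp ?_) (mul_le_mul_of_nonneg_left hmain hqp)
    (one_div_pos.2 hq).le
  exact setIntegral_nonneg measurableSet_Ioi fun t ht =>
    mul_nonneg (Real.rpow_nonneg (rearr_nonneg g t) _) (Real.rpow_nonneg (le_of_lt ht) _)
end

section
/- For every pair (p,q) with 2 ≤ q ≤ p < ∞, one has ∫₀^∞ (g*(t))^{q} t^{q/p−1} dt ≤ ∫₀^∞ e^{−π q t²/2} t^{q/p−1} dt, where g* is the non-increasing rearrangement of the function g(t) = |sin(πt)/(πt)| on (0,∞). -/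
open MeasureTheory Set Real Filter
open scoped ENNReal NNReal

/-- The function `g(t) = |sin (πt) / (πt)|`. -/
noncomputable def absSinc (t : ℝ) : ℝ := |Real.sin (π * t) / (π * t)|

/-- The Gaussian `G(t) = e^{-πt²/2}`. -/
noncomputable def gauss (t : ℝ) : ℝ := Real.exp (-(π * t ^ 2 / 2))

/-! ### The square integral of the cardinal sine -/

/-- The Dirichlet kernel in the variable `u = x / 2`. -/
noncomputable def dirichletSum (n : ℕ) (u : ℝ) : ℝ :=
  1 + 2 * ∑ k ∈ Finset.range n, Real.cos (2 * (k + 1) * u)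

/-- The unnormalised Fejér kernel in the variable `u = x / 2`. -/
noncomputable def fejerSum (N : ℕ) (u : ℝ) : ℝ := ∑ n ∈ Finset.range N, dirichletSum n u

lemma sin_mul_dirichletSum (n : ℕ) (u : ℝ) :
    Real.sin u * dirichletSum n u = Real.sin ((2 * n + 1) * u) := by
  induction n with
  | zero => simp [dirichletSum]
  | succ n ih =>
    have h : dirichletSum (n + 1) u = dirichletSum n u + 2 * Real.cos (2 * (n + 1) * u) := by
      simp only [dirichletSum, Finset.sum_range_succ]; ring
    rw [h, mul_add, ih]
    have h1 : (2 * (n : ℝ) + 1) * u = 2 * (n + 1) * u - u := by ring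
    have h2 : (2 * ((n + 1 : ℕ) : ℝ) + 1) * u = 2 * (n + 1) * u + u := by push_cast; ring
    rw [h1, h2, Real.sin_sub, Real.sin_add]
    ring

lemma sin_sq_mul_fejerSum (N : ℕ) (u : ℝ) :
    Real.sin u ^ 2 * fejerSum N u = Real.sin (N * u) ^ 2 := by
  induction N with
  | zero => simp [fejerSum]
  | succ n ih =>
    have h : fejerSum (n + 1) u = fejerSum n u + dirichletSum n u := by
      simp only [fejerSum, Finset.sum_range_succ]
    rw [h, mul_add, ih, sq (Real.sin u), mul_assoc, sin_mul_dirichletSum]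
    have h1 : (2 * (n : ℝ) + 1) * u = n * u + (n * u + u) := by ring
    have h2 : ((n + 1 : ℕ) : ℝ) * u = n * u + u := by push_cast; ring
    rw [h1, h2, Real.sin_add (n * u) (n * u + u), Real.sin_add, Real.cos_add]
    linear_combination (-Real.sin (n * u) ^ 2) * Real.sin_sq_add_cos_sq u

lemma continuous_dirichletSum (n : ℕ) : Continuous (dirichletSum n) := by
  unfold dirichletSum; fun_prop

lemma continuous_fejerSum (N : ℕ) : Continuous (fejerSum N) :=
  continuous_finsetSum _ fun n _ => continuous_dirichletSum n

lemma integral_dirichletSum (n : ℕ) : ∫ u in (0 : ℝ)..π / 2, dirichletSum n u = π / 2 := by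
  unfold dirichletSum
  have hc : ∀ k : ℕ, Continuous fun u : ℝ => Real.cos (2 * (k + 1) * u) := fun k => by fun_prop
  rw [intervalIntegral.integral_add (by simp)
    ((by fun_prop : Continuous fun u : ℝ =>
      2 * ∑ k ∈ Finset.range n, Real.cos (2 * (k + 1) * u)).intervalIntegrable _ _),
    intervalIntegral.integral_const_mul,
    intervalIntegral.integral_finsetSum fun k _ => (hc k).intervalIntegrable _ _]
  have h0 : ∀ k ∈ Finset.range n, ∫ u in (0 : ℝ)..π / 2, Real.cos (2 * (k + 1) * u) = 0 := by
    intro k _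
    have hk : (2 * ((k : ℝ) + 1)) ≠ 0 := by positivity
    rw [intervalIntegral.integral_comp_mul_left (fun x => Real.cos x) hk, integral_cos]
    have : 2 * ((k : ℝ) + 1) * (π / 2) = ((k + 1 : ℕ) : ℝ) * π := by push_cast; ring
    rw [this, Real.sin_nat_mul_pi]
    simp
  rw [Finset.sum_eq_zero h0]
  simp

lemma integral_fejerSum (N : ℕ) : ∫ u in (0 : ℝ)..π / 2, fejerSum N u = N * (π / 2) := by
  unfold fejerSum
  rw [intervalIntegral.integral_finsetSum
    fun n _ => (continuous_dirichletSum n).intervalIntegrable _ _]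
  simp [integral_dirichletSum]

lemma absSinc_nonneg (t : ℝ) : 0 ≤ absSinc t := abs_nonneg _

lemma measurable_absSinc : Measurable absSinc := by
  unfold absSinc
  simp only [← Real.norm_eq_abs]
  fun_prop

lemma absSinc_sq_le_fejerSum {N : ℕ} {t : ℝ} (ht : 0 < t) (htN : t ≤ N / 2) :
    absSinc t ^ 2 ≤ fejerSum N (π / N * t) / N ^ 2 := by
  have hN : (0 : ℝ) < N := by linarith
  set u := π / N * t with hu
  have hu0 : 0 < u := by positivity
  have hNu : N * u = π * t := by rw [hu]; field_simp
  have hupi : u < π := by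
    have : N * u < N * π := by rw [hNu]; nlinarith [Real.pi_pos]
    exact lt_of_mul_lt_mul_left this hN.le
  have hs : 0 < Real.sin u := Real.sin_pos_of_pos_of_lt_pi hu0 hupi
  have hF := sin_sq_mul_fejerSum N u
  have hF0 : 0 ≤ fejerSum N u := by
    have : 0 ≤ Real.sin u ^ 2 * fejerSum N u := by rw [hF]; positivity
    exact nonneg_of_mul_nonneg_right this (by positivity)
  have hle : Real.sin u ^ 2 ≤ u ^ 2 := by
    have := Real.sin_le hu0.le
    gcongr
  unfold absSinc
  rw [sq_abs, div_pow, ← hNu, ← hF, mul_pow, div_le_div_iff₀ (by positivity) (by positivity)]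
  have := mul_le_mul_of_nonneg_right hle (mul_nonneg hF0 (sq_nonneg (N : ℝ)))
  nlinarith

lemma setLIntegral_absSinc_sq_le (N : ℕ) :
    ∫⁻ t in Set.Ioc (0 : ℝ) (N / 2), ENNReal.ofReal (absSinc t ^ 2) ≤ ENNReal.ofReal (1 / 2) := by
  rcases Nat.eq_zero_or_pos N with rfl | hN
  · simp
  have hN' : (0 : ℝ) < N := by exact_mod_cast hN
  have hc : Continuous fun t : ℝ => fejerSum N (π / N * t) / N ^ 2 :=
    ((continuous_fejerSum N).comp (by fun_prop)).div_const _
  have hle : ∀ t ∈ Set.Ioc (0 : ℝ) (N / 2), absSinc t ^ 2 ≤ fejerSum N (π / N * t) / N ^ 2 :=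
    fun t ht => absSinc_sq_le_fejerSum ht.1 ht.2
  calc _ ≤ ∫⁻ t in Set.Ioc (0 : ℝ) (N / 2), ENNReal.ofReal (fejerSum N (π / N * t) / N ^ 2) :=
        setLIntegral_mono' measurableSet_Ioc fun t ht => ENNReal.ofReal_le_ofReal (hle t ht)
    _ = ENNReal.ofReal (∫ t in Set.Ioc (0 : ℝ) (N / 2), fejerSum N (π / N * t) / N ^ 2) := by
        rw [ofReal_integral_eq_lintegral_ofReal]
        · exact (hc.integrableOn_Icc).mono_set Set.Ioc_subset_Icc_self
        · filter_upwards [ae_restrict_mem measurableSet_Ioc] with t ht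
          exact (sq_nonneg _).trans (hle t ht)
    _ = ENNReal.ofReal (1 / 2) := by
        rw [← intervalIntegral.integral_of_le (by positivity), intervalIntegral.integral_div,
          intervalIntegral.integral_comp_mul_left _ (by positivity), mul_zero,
          show π / N * (N / 2) = π / 2 by field_simp, integral_fejerSum]
        congr 1
        rw [smul_eq_mul]
        field_simp

lemma lintegral_absSinc_sq_le :
    ∫⁻ t in Set.Ioi (0 : ℝ), ENNReal.ofReal (absSinc t ^ 2) ≤ ENNReal.ofReal (1 / 2) := by
  have hU : Set.Ioi (0 : ℝ) = ⋃ N : ℕ, Set.Ioc (0 : ℝ) (N / 2) := by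
    ext t
    simp only [Set.mem_Ioi, Set.mem_iUnion, Set.mem_Ioc]
    refine ⟨fun ht => ?_, fun ⟨_, h⟩ => h.1⟩
    obtain ⟨N, hN⟩ := exists_nat_ge (2 * t)
    exact ⟨N, ht, by linarith⟩
  have hm : Monotone fun N : ℕ => Set.Ioc (0 : ℝ) (N / 2) := by
    intro M N h
    have : (M : ℝ) ≤ N := by exact_mod_cast h
    exact Set.Ioc_subset_Ioc_right (by linarith)
  rw [hU, setLIntegral_iUnion_of_directed _ hm.directed_le]
  exact iSup_le setLIntegral_absSinc_sq_le

/-! ### The main lobe -/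

lemma sin_le_mul_exp {x : ℝ} (h0 : 0 ≤ x) (h1 : x ≤ 1) :
    Real.sin (π * x) ≤ π * x * Real.exp (-(π ^ 2 / 6 * x ^ 2)) := by
  have hz : HasSum (fun n : ℕ => (1 : ℝ) / ((n : ℝ) + 1) ^ 2) (π ^ 2 / 6) := by
    have := (hasSum_nat_add_iff' 1).2 hasSum_zeta_two
    simpa using this
  have hE : Tendsto (fun n : ℕ => π * x * Real.exp (-((∑ j ∈ Finset.range n,
      (1 : ℝ) / ((j : ℝ) + 1) ^ 2) * x ^ 2))) atTop
      (nhds (π * x * Real.exp (-(π ^ 2 / 6 * x ^ 2)))) :=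
    ((Real.continuous_exp.tendsto _).comp
      ((hz.tendsto_sum_nat.mul_const (x ^ 2)).neg)).const_mul _
  refine le_of_tendsto_of_tendsto' (Real.tendsto_euler_sin_prod x) hE fun n => ?_
  refine mul_le_mul_of_nonneg_left ?_ (by positivity)
  rw [Finset.sum_mul, ← Finset.sum_neg_distrib, Real.exp_sum]
  refine Finset.prod_le_prod (fun j _ => ?_) fun j _ => ?_
  · rw [sub_nonneg, div_le_one (by positivity)]
    have : (0 : ℝ) ≤ j := j.cast_nonneg
    gcongr
    linarith
  · have := Real.add_one_le_exp (-(1 / ((j : ℝ) + 1) ^ 2 * x ^ 2))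
    calc _ = -(1 / ((j : ℝ) + 1) ^ 2 * x ^ 2) + 1 := by ring
      _ ≤ _ := this

lemma absSinc_le_gauss {t : ℝ} (h0 : 0 < t) (h1 : t ≤ 1) : absSinc t ≤ gauss t := by
  have hp := Real.pi_pos
  have hs : 0 ≤ Real.sin (π * t) :=
    Real.sin_nonneg_of_nonneg_of_le_pi (by positivity) (by nlinarith)
  unfold absSinc gauss
  rw [abs_of_nonneg (by positivity), div_le_iff₀ (by positivity), mul_comm (Real.exp _)]
  refine (sin_le_mul_exp h0.le h1).trans ?_
  gcongr
  nlinarith [Real.pi_gt_three, mul_pos hp (pow_pos h0 2)]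

lemma gauss_pos (t : ℝ) : 0 < gauss t := Real.exp_pos _

lemma continuous_gauss : Continuous gauss := by unfold gauss; fun_prop

lemma gauss_lt_gauss {s t : ℝ} (hs : 0 ≤ s) (h : s < t) : gauss t < gauss s := by
  have hp := Real.pi_pos
  unfold gauss
  gcongr

/-- The measure of `{t > 0 : τ < g(t)}` for `g(t) = |sin (πt) / (πt)|`. -/
noncomputable def sincDistrib (τ : ℝ) : ℝ≥0∞ := volume {t : ℝ | 0 < t ∧ τ < absSinc t}

lemma distribFn_absSinc (τ : ℝ) : distribFn absSinc τ = sincDistrib τ := by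
  unfold distribFn sincDistrib
  rw [Measure.restrict_apply (measurableSet_lt measurable_const
    (measurable_absSinc.abs))]
  congr 1
  ext t
  simp [abs_of_nonneg (absSinc_nonneg t), and_comm]

/-! ### Values of the distribution function for small levels -/

lemma two_mul_le_sin_pi_mul {x : ℝ} (h0 : 0 ≤ x) (h1 : x ≤ 1 / 2) :
    2 * x ≤ Real.sin (π * x) := by
  have hp := Real.pi_pos
  have h := Real.mul_le_sin (x := π * x) (by positivity) (by nlinarith)
  have e : 2 / π * (π * x) = 2 * x := by field_simp
  linarith

lemma abs_sin_pi_mul_add_nat (k : ℕ) (r : ℝ) :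
    |Real.sin (π * (k + r))| = |Real.sin (π * r)| := by
  rw [show π * (k + r) = π * r + k * π by ring, Real.sin_add_nat_mul_pi, abs_mul]
  simp

lemma lt_absSinc_iff {t y : ℝ} (ht : 0 < t) :
    y < absSinc t ↔ y * (π * t) < |Real.sin (π * t)| := by
  have hp := Real.pi_pos
  unfold absSinc
  rw [abs_div, abs_of_pos (by positivity : 0 < π * t), lt_div_iff₀ (by positivity)]

lemma lt_absSinc_of_dist {y : ℝ} (hy : 0 < y) (k : ℕ) {r : ℝ}
    (h1 : π * (k + 1) * y / 2 < r) (h2 : r < 1 - π * (k + 1) * y / 2) :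
    y < absSinc (k + r) := by
  have hp := Real.pi_pos
  have hc : 0 < π * (k + 1) * y / 2 := by positivity
  have hr : 0 < r := hc.trans h1
  have hr1 : r < 1 := by linarith
  rw [lt_absSinc_iff (by positivity), abs_sin_pi_mul_add_nat]
  have hlow : π * (k + 1) * y < Real.sin (π * r) := by
    rcases le_total r (1 / 2) with h | h
    · linarith [two_mul_le_sin_pi_mul hr.le h]
    · have h' := two_mul_le_sin_pi_mul (x := 1 - r) (by linarith) (by linarith)
      rw [show π * (1 - r) = π - π * r by ring, Real.sin_pi_sub] at h'
      linarith
  calc y * (π * (k + r)) ≤ y * (π * (k + 1)) := by gcongr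
    _ = π * (k + 1) * y := by ring
    _ < _ := hlow
    _ ≤ _ := le_abs_self _

lemma le_volume_absSinc_lobes {y : ℝ} (hy : 0 < y) (N : ℕ) :
    ENNReal.ofReal (N - π * y * (N * (N + 1) / 2)) ≤
      volume {t : ℝ | 0 < t ∧ t < N ∧ y < absSinc t} := by
  have hp := Real.pi_pos
  induction N with
  | zero => simp
  | succ n ih =>
    set c := π * (n + 1) * y with hc
    have hc0 : 0 < c := by positivity
    set S := {t : ℝ | 0 < t ∧ t < n ∧ y < absSinc t} with hS
    have hdisj : Disjoint S (Set.Ioo (n + c / 2) (n + 1 - c / 2)) := by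
      rw [Set.disjoint_left]
      rintro t ⟨_, h, _⟩ ⟨h', _⟩
      linarith
    have hsub : S ∪ Set.Ioo (n + c / 2) (n + 1 - c / 2) ⊆
        {t : ℝ | 0 < t ∧ t < (n + 1 : ℕ) ∧ y < absSinc t} := by
      rintro t (⟨h1, h2, h3⟩ | ⟨h1, h2⟩)
      · exact ⟨h1, by push_cast; linarith, h3⟩
      · have hn : (0 : ℝ) ≤ n := n.cast_nonneg
        refine ⟨by linarith, by push_cast; linarith, ?_⟩
        have := lt_absSinc_of_dist hy n (r := t - n) (by linarith) (by linarith)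
        simpa using this
    calc ENNReal.ofReal ((n + 1 : ℕ) - π * y * ((n + 1 : ℕ) * ((n + 1 : ℕ) + 1) / 2))
        = ENNReal.ofReal ((n - π * y * (n * (n + 1) / 2)) +
            ((n + 1 - c / 2) - (n + c / 2))) := by
          congr 1; rw [hc]; push_cast; ring
      _ ≤ ENNReal.ofReal (n - π * y * (n * (n + 1) / 2)) +
            ENNReal.ofReal ((n + 1 - c / 2) - (n + c / 2)) := ENNReal.ofReal_add_le
      _ ≤ volume S + volume (Set.Ioo (n + c / 2) (n + 1 - c / 2)) := by
          rw [Real.volume_Ioo]; gcongr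
      _ = volume (S ∪ Set.Ioo (n + c / 2) (n + 1 - c / 2)) :=
          (measure_union hdisj measurableSet_Ioo).symm
      _ ≤ _ := measure_mono hsub

lemma le_sincDistrib_lobes {y : ℝ} (hy : 0 < y) (N : ℕ) :
    ENNReal.ofReal (N - π * y * (N * (N + 1) / 2)) ≤ sincDistrib y :=
  (le_volume_absSinc_lobes hy N).trans (measure_mono fun _ h => ⟨h.1, h.2.2⟩)

lemma sin_le_sin_pi_mul {a b x : ℝ} (ha : 0 ≤ a) (hb : b ≤ 1) (h1 : a ≤ x) (h2 : x ≤ b) :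
    min (Real.sin (π * a)) (Real.sin (π * b)) ≤ Real.sin (π * x) := by
  have hp := Real.pi_pos
  refine strictConcaveOn_sin_Icc.concaveOn.min_le_of_mem_Icc ?_ ?_ ?_
  · exact ⟨by positivity, by nlinarith⟩
  · exact ⟨mul_nonneg hp.le (by linarith), by nlinarith⟩
  · exact ⟨by gcongr, by gcongr⟩

lemma five_quarters_le_sincDistrib {y : ℝ} (hy : 0 < y) (hy1 : y ≤ 41 / 250) :
    ENNReal.ofReal (5 / 4) ≤ sincDistrib y := by
  have hp := Real.pi_pos
  have hp2 := Real.pi_lt_d2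
  have hπy : y * π ≤ 41 / 250 * 3.15 := by gcongr
  have hπy' : y * π ≤ 0.5166 := by linarith
  have s6 : Real.sin (π * (1 / 6)) = 1 / 2 := by
    rw [← Real.sin_pi_div_six]; congr 1; ring
  have s56 : Real.sin (π * (5 / 6)) = 1 / 2 := by
    rw [← Real.sin_pi_div_six, ← Real.sin_pi_sub]; congr 1; ring
  have s4 : Real.sin (π * (1 / 4)) = √2 / 2 := by
    rw [← Real.sin_pi_div_four]; congr 1; ring
  have s3 : Real.sin (π * (1 / 3)) = √3 / 2 := by
    rw [← Real.sin_pi_div_three]; congr 1; ring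
  have s23 : Real.sin (π * (2 / 3)) = √3 / 2 := by
    rw [← Real.sin_pi_div_three, ← Real.sin_pi_sub]; congr 1; ring
  have q2 : 1.414 < √2 := Real.lt_sqrt_of_sq_lt (by norm_num)
  have q3 : 1.732 < √3 := Real.lt_sqrt_of_sq_lt (by norm_num)
  have hsub : Set.Ioo (0 : ℝ) (5 / 6) ∪ Set.Ioo (5 / 4) (5 / 3) ⊆
      {t : ℝ | 0 < t ∧ y < absSinc t} := by
    rintro t (⟨h1, h2⟩ | ⟨h1, h2⟩)
    · refine ⟨h1, (lt_absSinc_iff h1).2 (lt_of_lt_of_le ?_ (le_abs_self _))⟩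
      rcases le_total t (1 / 6) with h | h
      · have := two_mul_le_sin_pi_mul h1.le (by linarith)
        nlinarith
      · have := sin_le_sin_pi_mul (a := 1 / 6) (b := 5 / 6) (by norm_num) (by norm_num) h h2.le
        rw [s6, s56, min_self] at this
        nlinarith
    · have h0 : 0 < t := by linarith
      refine ⟨h0, (lt_absSinc_iff h0).2 ?_⟩
      have e := abs_sin_pi_mul_add_nat 1 (t - 1)
      rw [Nat.cast_one, add_sub_cancel] at e
      rw [e]
      refine lt_of_lt_of_le ?_ (le_abs_self _)
      rcases le_total (t - 1) (1 / 3) with h | h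
      · have := sin_le_sin_pi_mul (a := 1 / 4) (b := 1 / 3) (by norm_num) (by norm_num)
          (by linarith) h
        rw [s4, s3] at this
        have : 0.707 ≤ Real.sin (π * (t - 1)) :=
          (le_min (by linarith) (by linarith)).trans this
        nlinarith
      · have := sin_le_sin_pi_mul (a := 1 / 3) (b := 2 / 3) (by norm_num) (by norm_num)
          h (by linarith)
        rw [s3, s23, min_self] at this
        nlinarith
  have hdisj : Disjoint (Set.Ioo (0 : ℝ) (5 / 6)) (Set.Ioo (5 / 4) (5 / 3)) := by
    rw [Set.disjoint_left]
    rintro t ⟨_, h⟩ ⟨h', _⟩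
    linarith
  calc ENNReal.ofReal (5 / 4) = ENNReal.ofReal (5 / 6 - 0) + ENNReal.ofReal (5 / 3 - 5 / 4) := by
        rw [← ENNReal.ofReal_add (by norm_num) (by norm_num)]; norm_num
    _ = volume (Set.Ioo (0 : ℝ) (5 / 6) ∪ Set.Ioo (5 / 4) (5 / 3)) := by
        rw [measure_union hdisj measurableSet_Ioo, Real.volume_Ioo, Real.volume_Ioo]
    _ ≤ _ := measure_mono hsub

/-- An upper bound for `gauss s` from a lower bound `c` for `exp` at a nearby point `u`. -/
lemma mul_gauss_le_one {c u s : ℝ} (hu : c ≤ Real.exp u)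
    (hs : u ≤ π * s ^ 2 / 2) : c * (1 + (π * s ^ 2 / 2 - u)) * gauss s ≤ 1 := by
  have h1 : c * (1 + (π * s ^ 2 / 2 - u)) ≤ Real.exp (π * s ^ 2 / 2) := by
    have := Real.add_one_le_exp (π * s ^ 2 / 2 - u)
    calc _ ≤ Real.exp u * Real.exp (π * s ^ 2 / 2 - u) := by
          gcongr
          linarith
      _ = _ := by rw [← Real.exp_add]; congr 1; ring
  calc _ ≤ Real.exp (π * s ^ 2 / 2) * gauss s := by
        gcongr
        exact (gauss_pos s).le
    _ = 1 := by unfold gauss; rw [← Real.exp_add]; simp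

lemma lt_sincDistrib_gauss {s : ℝ} (hs : 27 / 25 ≤ s) :
    ENNReal.ofReal s < sincDistrib (gauss s) := by
  have hp := Real.pi_pos
  have hp1 := Real.pi_gt_d4
  have hp2 := Real.pi_lt_d4
  have hg := gauss_pos s
  rcases lt_or_ge s (5 / 4) with h | h
  · have he : (6.1 : ℝ) ≤ Real.exp 1.83 := by
      refine le_trans ?_ (Real.sum_le_exp_of_nonneg (by norm_num) 9)
      norm_num [Finset.sum_range_succ, Nat.factorial]
    have hle : 1.83 ≤ π * s ^ 2 / 2 := by nlinarith
    have := mul_gauss_le_one he hle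
    have hy : gauss s ≤ 41 / 250 := by nlinarith [mul_nonneg (sub_nonneg.2 hle) hg.le]
    refine lt_of_lt_of_le ?_ (five_quarters_le_sincDistrib hg hy)
    exact (ENNReal.ofReal_lt_ofReal_iff (by norm_num)).2 h
  rcases lt_or_ge s (137 / 100) with h' | h'
  · have he : (11.63 : ℝ) ≤ Real.exp 2.4542 := by
      refine le_trans ?_ (Real.sum_le_exp_of_nonneg (by norm_num) 12)
      norm_num [Finset.sum_range_succ, Nat.factorial]
    have hle : 2.4542 ≤ π * s ^ 2 / 2 := by nlinarith
    have := mul_gauss_le_one he hle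
    have hy : gauss s ≤ 1 / 11.63 := by
      rw [le_div_iff₀ (by norm_num)]
      nlinarith [mul_nonneg (sub_nonneg.2 hle) hg.le]
    refine lt_of_lt_of_le ?_ (le_sincDistrib_lobes hg 3)
    have hm : π * gauss s ≤ 3.1416 * (1 / 11.63) := by gcongr
    refine (ENNReal.ofReal_lt_ofReal_iff ?_).2 ?_
    · push_cast; norm_num at hm ⊢; linarith
    · push_cast; norm_num at hm ⊢; linarith
  · have he : (19 : ℝ) ≤ Real.exp 2.948 := by
      refine le_trans ?_ (Real.sum_le_exp_of_nonneg (by norm_num) 14)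
      norm_num [Finset.sum_range_succ, Nat.factorial]
    have hle : 2.948 ≤ π * s ^ 2 / 2 := by nlinarith
    have := mul_gauss_le_one he hle
    have hk : 2 * π * (s + 1) ≤ 19 * (1 + (π * s ^ 2 / 2 - 2.948)) := by nlinarith
    have hy : 2 * π * (s + 1) * gauss s ≤ 1 :=
      (mul_le_mul_of_nonneg_right hk hg.le).trans this
    set N := ⌊2 * s⌋₊ + 1 with hN
    have hN1 : 2 * s < N := by rw [hN]; push_cast; exact Nat.lt_floor_add_one _
    have hN2 : (N : ℝ) ≤ 2 * s + 1 := by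
      rw [hN]; push_cast; linarith [Nat.floor_le (show 0 ≤ 2 * s by linarith)]
    refine lt_of_lt_of_le ?_ (le_sincDistrib_lobes hg N)
    have hb : π * gauss s * (N + 1) ≤ 1 := by
      calc _ ≤ π * gauss s * (2 * s + 1 + 1) := by gcongr
        _ = 2 * π * (s + 1) * gauss s := by ring
        _ ≤ 1 := hy
    have hlt : s < N - π * gauss s * (N * (N + 1) / 2) := by
      have : π * gauss s * (N * (N + 1) / 2) = π * gauss s * (N + 1) * (N / 2) := by ring
      rw [this]
      nlinarith [mul_le_mul_of_nonneg_right hb (show (0 : ℝ) ≤ N / 2 by positivity)]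
    exact (ENNReal.ofReal_lt_ofReal_iff (by linarith)).2 hlt

/-! ### The first side lobe -/

lemma absSinc_le_third {t : ℝ} (ht : 1 ≤ t) : absSinc t ≤ 1 / 3 := by
  have hp := Real.pi_gt_three
  unfold absSinc
  rw [abs_div, abs_of_pos (by positivity : 0 < π * t)]
  have h3 : 3 ≤ π * t := by nlinarith
  exact div_le_div₀ zero_le_one (Real.abs_sin_le_one _) (by norm_num) h3

lemma hasDerivAt_sinc_pi {t : ℝ} (ht : 0 < t) :
    HasDerivAt (fun t : ℝ => Real.sin (π * t) / (π * t))
      ((Real.cos (π * t) * π * (π * t) - Real.sin (π * t) * π) / (π * t) ^ 2) t := by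
  have hp := Real.pi_pos
  have h1 : HasDerivAt (fun t : ℝ => π * t) π t := by
    simpa using (hasDerivAt_id t).const_mul π
  exact h1.sin.div h1 (by positivity)

lemma lipschitzOnWith_absSinc : LipschitzOnWith (53 / 50) absSinc (Set.Icc 1 2) := by
  have hp := Real.pi_gt_three
  have hL : LipschitzOnWith (53 / 50) (fun t : ℝ => Real.sin (π * t) / (π * t))
      (Set.Icc 1 2) := by
    refine (convex_Icc 1 2).lipschitzOnWith_of_nnnorm_hasDerivWithin_le
      (fun t ht => (hasDerivAt_sinc_pi (by linarith [ht.1])).hasDerivWithinAt) fun t ht => ?_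
    rw [← NNReal.coe_le_coe, coe_nnnorm, Real.norm_eq_abs]
    have ht1 := ht.1
    set a := Real.cos (π * t)
    set b := Real.sin (π * t)
    have hab : b ^ 2 + a ^ 2 = 1 := Real.sin_sq_add_cos_sq _
    have hT : 0 < π * t := by positivity
    have hpp : 9 ≤ π ^ 2 := by nlinarith
    have htt : 1 ≤ t ^ 2 := by nlinarith
    have e : (a * π * (π * t) - b * π) / (π * t) ^ 2 = (a * (π * t) - b) / (π * t * t) := by
      field_simp
    rw [e, abs_div, abs_of_pos (by positivity : 0 < π * t * t), div_le_iff₀ (by positivity)]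
    push_cast
    refine abs_le_of_sq_le_sq ?_ (by positivity)
    have h1 : (a * (π * t) - b) ^ 2 ≤ (π * t) ^ 2 + 1 := by
      have : (a * (π * t) - b) ^ 2 + (a + b * (π * t)) ^ 2 = (π * t) ^ 2 + 1 := by
        linear_combination ((π * t) ^ 2 + 1) * hab
      nlinarith [sq_nonneg (a + b * (π * t))]
    have h2 : 9 ≤ (π * t) ^ 2 := by rw [mul_pow]; nlinarith
    nlinarith [mul_le_mul_of_nonneg_left htt (sq_nonneg (π * t))]
  refine LipschitzOnWith.of_dist_le_mul fun x hx y hy => ?_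
  exact (abs_abs_sub_abs_le _ _).trans (hL.dist_le_mul x hx y hy)

lemma ofReal_sub_le_volume_level {a b y y' : ℝ} (ha : 1 ≤ a) (hab : a ≤ b) (hb : b ≤ 2)
    (h : absSinc a ≤ y ∧ y' ≤ absSinc b ∨ y' ≤ absSinc a ∧ absSinc b ≤ y) :
    ENNReal.ofReal (y' - y) ≤
      ((53 / 50 : ℝ≥0) : ℝ≥0∞) * volume (Set.Ioo a b ∩ {t | y < absSinc t ∧ absSinc t < y'}) := by
  set S := Set.Ioo a b ∩ {t | y < absSinc t ∧ absSinc t < y'} with hS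
  have hL : LipschitzOnWith (53 / 50) absSinc (Set.Icc a b) :=
    lipschitzOnWith_absSinc.mono (Set.Icc_subset_Icc ha hb)
  have hsub : Set.Ioo y y' ⊆ absSinc '' S := by
    rintro v ⟨hv1, hv2⟩
    have hc : ContinuousOn absSinc (Set.uIcc a b) := by
      rw [Set.uIcc_of_le hab]; exact hL.continuousOn
    have hv : v ∈ Set.uIcc (absSinc a) (absSinc b) := by
      rw [Set.mem_uIcc]
      rcases h with ⟨h1, h2⟩ | ⟨h1, h2⟩
      · left; constructor <;> linarith
      · right; constructor <;> linarith
    obtain ⟨t, ht, rfl⟩ := intermediate_value_uIcc hc hv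
    rw [Set.uIcc_of_le hab] at ht
    have hta : t ≠ a := by
      rintro rfl
      rcases h with ⟨h1, _⟩ | ⟨h1, _⟩ <;> linarith
    have htb : t ≠ b := by
      rintro rfl
      rcases h with ⟨_, h1⟩ | ⟨_, h1⟩ <;> linarith
    exact ⟨t, ⟨⟨lt_of_le_of_ne ht.1 hta.symm, lt_of_le_of_ne ht.2 htb⟩, hv1, hv2⟩, rfl⟩
  have hH := (hL.mono (show S ⊆ Set.Icc a b from
    fun t ht => Set.Ioo_subset_Icc_self ht.1)).hausdorffMeasure_image_le zero_le_one
  rw [hausdorffMeasure_real, ENNReal.rpow_one] at hH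
  calc ENNReal.ofReal (y' - y) = volume (Set.Ioo y y') := Real.volume_Ioo.symm
    _ ≤ volume (absSinc '' S) := measure_mono hsub
    _ ≤ _ := hH

lemma exists_peak : ∃ τ ∈ Set.Icc (1 : ℝ) 2, ∀ t, 1 ≤ t → absSinc t ≤ absSinc τ := by
  have hp := Real.pi_pos
  obtain ⟨τ, hτ, hmax⟩ := isCompact_Icc.exists_isMaxOn (⟨1, by simp⟩ : (Set.Icc (1 : ℝ) 2).Nonempty)
    lipschitzOnWith_absSinc.continuousOn
  refine ⟨τ, hτ, fun t ht => ?_⟩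
  have hk : 1 ≤ ⌊t⌋₊ := Nat.one_le_floor_iff t |>.2 ht
  obtain ⟨k, hk⟩ := Nat.exists_eq_add_of_le' hk
  have h1 : (k : ℝ) + 1 ≤ t := by
    have := Nat.floor_le (show 0 ≤ t by linarith)
    rw [hk] at this; exact_mod_cast this
  have h2 : t < k + 1 + 1 := by
    have := Nat.lt_floor_add_one t
    rw [hk] at this; exact_mod_cast this
  have hk0 : (0 : ℝ) ≤ k := k.cast_nonneg
  refine le_trans ?_ (hmax (a := t - k) ⟨by linarith, by linarith⟩)
  have e := abs_sin_pi_mul_add_nat k (t - k)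
  rw [add_sub_cancel] at e
  show absSinc t ≤ absSinc (t - k)
  have hpos : 0 < t - k := by linarith
  unfold absSinc
  rw [abs_div, abs_div, abs_of_pos (by positivity : 0 < π * t),
    abs_of_pos (by positivity : 0 < π * (t - k)), e]
  gcongr
  linarith

lemma sincDistrib_add_le {τ y y' : ℝ} (hτ : τ ∈ Set.Icc (1 : ℝ) 2) (hy : 0 < y) (hyy' : y < y')
    (hy' : y' ≤ absSinc τ) :
    sincDistrib y' + ENNReal.ofReal (100 / 53 * (y' - y)) ≤ sincDistrib y := by
  set L := {t | y < absSinc t ∧ absSinc t < y'} with hL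
  have hLm : MeasurableSet L :=
    (measurableSet_lt measurable_const measurable_absSinc).inter
      (measurableSet_lt measurable_absSinc measurable_const)
  have z1 : absSinc 1 = 0 := by simp [absSinc]
  have z2 : absSinc 2 = 0 := by simp [absSinc, mul_comm π 2]
  have h1 := ofReal_sub_le_volume_level le_rfl hτ.1 hτ.2 (y := y) (y' := y')
    (Or.inl ⟨by rw [z1]; exact hy.le, hy'⟩)
  have h2 := ofReal_sub_le_volume_level hτ.1 hτ.2 le_rfl (y := y) (y' := y')
    (Or.inr ⟨hy', by rw [z2]; exact hy.le⟩)
  rw [← hL] at h1 h2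
  have key : ENNReal.ofReal (100 / 53 * (y' - y)) ≤
      volume (Set.Ioo 1 τ ∩ L) + volume (Set.Ioo τ 2 ∩ L) := by
    have h := add_le_add h1 h2
    rw [← mul_add, ← ENNReal.ofReal_add (by linarith) (by linarith)] at h
    have h' := mul_le_mul_right h (ENNReal.ofReal (50 / 53))
    have hc : ((53 / 50 : ℝ≥0) : ℝ≥0∞) = ENNReal.ofReal (53 / 50) := by
      rw [ENNReal.ofReal]
      congr 1
      ext
      rw [Real.coe_toNNReal _ (by norm_num)]
      norm_num
    rw [hc, ← mul_assoc, ← ENNReal.ofReal_mul (by norm_num), ← ENNReal.ofReal_mul (by norm_num),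
      show (50 / 53 * (53 / 50) : ℝ) = 1 by norm_num, ENNReal.ofReal_one, one_mul] at h'
    refine le_trans (le_of_eq ?_) h'
    congr 1
    ring
  have hd1 : Disjoint (Set.Ioo 1 τ ∩ L) (Set.Ioo τ 2 ∩ L) := by
    rw [Set.disjoint_left]
    rintro t ⟨⟨_, h⟩, _⟩ ⟨⟨h', _⟩, _⟩
    linarith
  have hd2 : Disjoint {t : ℝ | 0 < t ∧ y' < absSinc t} (Set.Ioo 1 τ ∩ L ∪ Set.Ioo τ 2 ∩ L) := by
    rw [Set.disjoint_left]
    rintro t ⟨_, h⟩ (⟨_, _, h'⟩ | ⟨_, _, h'⟩) <;> linarith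
  calc _ ≤ sincDistrib y' + (volume (Set.Ioo 1 τ ∩ L) + volume (Set.Ioo τ 2 ∩ L)) := by gcongr
    _ = volume ({t : ℝ | 0 < t ∧ y' < absSinc t} ∪ (Set.Ioo 1 τ ∩ L ∪ Set.Ioo τ 2 ∩ L)) := by
        rw [measure_union hd2 ((measurableSet_Ioo.inter hLm).union (measurableSet_Ioo.inter hLm)),
          measure_union hd1 (measurableSet_Ioo.inter hLm)]
        rfl
    _ ≤ _ := by
        refine measure_mono ?_
        rintro t (⟨h0, h⟩ | ⟨⟨h0, _⟩, h, _⟩ | ⟨⟨h0, _⟩, h, _⟩)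
        · exact ⟨h0, hyy'.trans h⟩
        · exact ⟨by linarith, h⟩
        · exact ⟨by linarith [hτ.1], h⟩

lemma gauss_sub_gauss_ge {s t : ℝ} (hs : 1 / 2 ≤ s) (hst : s ≤ t) (ht : t ≤ 27 / 25) :
    53 / 100 * (t - s) ≤ gauss s - gauss t := by
  have hp1 := Real.pi_gt_d4
  have hp2 := Real.pi_lt_d4
  have hd : ∀ x : ℝ, HasDerivAt (fun x => gauss x + 53 / 100 * x)
      (gauss x * -(π * x) + 53 / 100) x := by
    intro x
    have h1 : HasDerivAt (fun x : ℝ => -(π * x ^ 2 / 2)) (-(π * x)) x := by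
      have := (((hasDerivAt_pow 2 x).const_mul π).div_const 2).neg
      convert! this using 1
      push_cast
      ring
    have h2 : HasDerivAt (fun x : ℝ => 53 / 100 * x) (53 / 100) x := by
      simpa using (hasDerivAt_id x).const_mul (53 / 100 : ℝ)
    exact h1.exp.add h2
  have he : 0.1826 ≤ Real.exp (-1.7) := by
    have h17 : Real.exp 1.7 ≤ 5.476 := by
      refine le_of_pow_le_pow_left₀ (n := 10) (by norm_num) (by norm_num) ?_
      rw [← Real.exp_nat_mul, show ((10 : ℕ) : ℝ) * 1.7 = ((17 : ℕ) : ℝ) * 1 by norm_num,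
        Real.exp_nat_mul]
      have := Real.exp_one_lt_d9.le
      calc Real.exp 1 ^ 17 ≤ 2.7182818286 ^ 17 := by gcongr
        _ ≤ _ := by norm_num
    rw [Real.exp_neg, ← one_div, le_div_iff₀ (Real.exp_pos _)]
    linarith
  have hanti : AntitoneOn (fun x => gauss x + 53 / 100 * x) (Set.Icc (1 / 2) (27 / 25)) := by
    refine antitoneOn_of_deriv_nonpos (convex_Icc _ _)
      (fun x _ => (hd x).continuousAt.continuousWithinAt)
      (fun x _ => (hd x).differentiableAt.differentiableWithinAt) fun x hx => ?_
    rw [interior_Icc] at hx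
    rw [(hd x).deriv]
    obtain ⟨h1, h2⟩ := hx
    have hu : π * x ^ 2 / 2 ≤ 1.5708 * x ^ 2 := by nlinarith [sq_nonneg x]
    have hpos : 0 ≤ 2.7 - 1.5708 * x ^ 2 := by nlinarith
    have hg : 0.1826 * (2.7 - 1.5708 * x ^ 2) ≤ gauss x := by
      have := Real.add_one_le_exp (1.7 - π * x ^ 2 / 2)
      calc _ ≤ Real.exp (-1.7) * Real.exp (1.7 - π * x ^ 2 / 2) := by
            gcongr
            linarith
        _ = _ := by unfold gauss; rw [← Real.exp_add]; congr 1; ring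
    have hx1 : 3.1415 * x ≤ π * x := by nlinarith
    have hm : 0.1826 * (2.7 - 1.5708 * x ^ 2) * (3.1415 * x) ≤ gauss x * (π * x) :=
      mul_le_mul hg hx1 (by linarith) (gauss_pos x).le
    have hq : 53 / 100 ≤ 0.1826 * (2.7 - 1.5708 * x ^ 2) * (3.1415 * x) := by
      nlinarith [mul_nonneg (sub_nonneg.2 h1.le) (sub_nonneg.2 h2.le),
        mul_nonneg (mul_nonneg (sub_nonneg.2 h1.le) (sub_nonneg.2 h2.le)) (show 0 ≤ x by linarith)]
    linarith
  have := hanti ⟨hs, by linarith⟩ ⟨by linarith, ht⟩ hst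
  simp only at this
  linarith

/-! ### The distribution functions cross exactly once -/

lemma half_le_gauss_half : 1 / 2 ≤ gauss (1 / 2) := by
  have := Real.add_one_le_exp (-(π * (1 / 2) ^ 2 / 2))
  unfold gauss
  linarith [Real.pi_lt_d2]

lemma sincDistrib_gauss_le {τ s : ℝ} (hτ : ∀ t, 1 ≤ t → absSinc t ≤ absSinc τ) (hs : 0 < s)
    (h : absSinc τ ≤ gauss s) : sincDistrib (gauss s) ≤ ENNReal.ofReal s := by
  have hsub : {t : ℝ | 0 < t ∧ gauss s < absSinc t} ⊆ Set.Ioc 0 s := by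
    rintro t ⟨h0, hlt⟩
    refine ⟨h0, ?_⟩
    by_contra! hst
    rcases le_total t 1 with h1 | h1
    · linarith [absSinc_le_gauss h0 h1, gauss_lt_gauss hs.le hst]
    · linarith [hτ t h1]
  calc _ ≤ volume (Set.Ioc 0 s) := measure_mono hsub
    _ = _ := by simp

theorem exists_crossing : ∃ s₀ : ℝ, 0 < s₀ ∧
    (∀ s, 0 < s → s < s₀ → sincDistrib (gauss s) ≤ ENNReal.ofReal s) ∧
    ∀ s, s₀ < s → ENNReal.ofReal s < sincDistrib (gauss s) := by
  obtain ⟨τ, hτI, hτ⟩ := exists_peak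
  have hτ3 := absSinc_le_third hτI.1
  set A := {s : ℝ | 0 < s ∧ sincDistrib (gauss s) ≤ ENNReal.ofReal s} with hA
  have hhalf : 1 / 2 ∈ A :=
    ⟨by norm_num, sincDistrib_gauss_le hτ (by norm_num) (by linarith [half_le_gauss_half])⟩
  have hlt : ∀ s ∈ A, s < 27 / 25 := by
    intro s hs
    by_contra! h
    exact (lt_sincDistrib_gauss h).not_ge hs.2
  have hbdd : BddAbove A := ⟨27 / 25, fun s hs => (hlt s hs).le⟩
  have hdown : ∀ s ∈ A, ∀ r, 0 < r → r < s → r ∈ A := by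
    intro s hs r hr hrs
    refine ⟨hr, ?_⟩
    rcases le_or_gt (absSinc τ) (gauss r) with h | h
    · exact sincDistrib_gauss_le hτ hr h
    have hr2 : 1 / 2 ≤ r := by
      by_contra! h'
      linarith [gauss_lt_gauss hr.le h', half_le_gauss_half]
    have h1 := sincDistrib_add_le hτI (gauss_pos s) (gauss_lt_gauss hr.le hrs) h.le
    have h2 := gauss_sub_gauss_ge hr2 hrs.le (hlt s hs).le
    have h3 : ENNReal.ofReal (s - r) ≤ ENNReal.ofReal (100 / 53 * (gauss r - gauss s)) :=
      ENNReal.ofReal_le_ofReal (by linarith)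
    have h4 : sincDistrib (gauss r) + ENNReal.ofReal (s - r) ≤
        ENNReal.ofReal r + ENNReal.ofReal (s - r) := by
      calc _ ≤ sincDistrib (gauss s) := (by gcongr : _ ≤ _).trans h1
        _ ≤ ENNReal.ofReal s := hs.2
        _ = _ := by rw [← ENNReal.ofReal_add hr.le (by linarith)]; congr 1; ring
    exact (ENNReal.add_le_add_iff_right ENNReal.ofReal_ne_top).1 h4
  have hpos : 0 < sSup A := lt_of_lt_of_le (by norm_num) (le_csSup hbdd hhalf)
  refine ⟨sSup A, hpos, fun s hs0 hs => ?_, fun s hs => ?_⟩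
  · obtain ⟨a, ha, hsa⟩ := exists_lt_of_lt_csSup ⟨_, hhalf⟩ hs
    exact (hdown a ha s hs0 hsa).2
  · by_contra! h
    exact (le_csSup hbdd ⟨hpos.trans hs, h⟩).not_gt hs

/-! ### The rearrangement -/

lemma distribFn_absSinc_one : distribFn absSinc 1 = 0 := by
  rw [distribFn_absSinc]
  unfold sincDistrib
  convert! measure_empty (μ := (volume : Measure ℝ))
  rw [Set.eq_empty_iff_forall_notMem]
  rintro t ⟨h0, h⟩
  have h1 : absSinc t ≤ 1 := by
    unfold absSinc
    rw [abs_div]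
    exact div_le_one_of_le₀ Real.abs_sin_le_abs (abs_nonneg _)
  linarith

lemma rearr_bddBelow (f : ℝ → ℝ) (s : ℝ) :
    BddBelow {τ : ℝ | 0 < τ ∧ distribFn f τ ≤ ENNReal.ofReal s} :=
  ⟨0, fun _ h => h.1.le⟩

lemma rearr_absSinc_nonempty (s : ℝ) :
    {τ : ℝ | 0 < τ ∧ distribFn absSinc τ ≤ ENNReal.ofReal s}.Nonempty :=
  ⟨1, one_pos, by rw [distribFn_absSinc_one]; exact zero_le⟩

lemma antitone_rearr_absSinc : Antitone (rearr absSinc) := fun s _ hst =>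
  csInf_le_csInf (rearr_bddBelow _ _) (rearr_absSinc_nonempty s)
    fun _ h => ⟨h.1, h.2.trans (ENNReal.ofReal_le_ofReal hst)⟩

lemma volume_rearr_absSinc_le {τ : ℝ} (hτ : 0 < τ) :
    volume.restrict (Set.Ioi 0) {s | τ < rearr absSinc s} ≤
      volume.restrict (Set.Ioi 0) {s | τ < absSinc s} := by
  have hd : volume.restrict (Set.Ioi 0) {s | τ < absSinc s} = distribFn absSinc τ := by
    unfold distribFn
    simp only [abs_of_nonneg (absSinc_nonneg _)]
  rw [hd]
  rcases eq_or_ne (distribFn absSinc τ) ⊤ with h | h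
  · rw [h]; exact le_top
  rw [Measure.restrict_apply' measurableSet_Ioi]
  calc _ ≤ volume (Set.Ioc 0 (distribFn absSinc τ).toReal) := by
        refine measure_mono ?_
        rintro s ⟨h1, h2⟩
        refine ⟨h2, ?_⟩
        by_contra! h3
        have := rearr_le hτ ((ENNReal.le_ofReal_iff_toReal_le h (le_of_lt h2)).2 h3.le)
        exact this.not_gt h1
    _ = _ := by rw [Real.volume_Ioc, sub_zero, ENNReal.ofReal_toReal h]

lemma lintegral_rearr_absSinc_sq_le :
    ∫⁻ t in Set.Ioi (0 : ℝ), ENNReal.ofReal (rearr absSinc t ^ 2) ≤ ENNReal.ofReal (1 / 2) := by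
  refine le_trans ?_ lintegral_absSinc_sq_le
  have h1 := lintegral_rpow_eq_lintegral_meas_lt_mul (volume.restrict (Set.Ioi (0 : ℝ)))
    (Eventually.of_forall (rearr_nonneg absSinc)) antitone_rearr_absSinc.measurable.aemeasurable
    two_pos
  have h2 := lintegral_rpow_eq_lintegral_meas_lt_mul (volume.restrict (Set.Ioi (0 : ℝ)))
    (Eventually.of_forall absSinc_nonneg) measurable_absSinc.aemeasurable two_pos
  simp only [Real.rpow_two] at h1 h2
  rw [h1, h2]
  exact mul_le_mul' le_rfl (setLIntegral_mono' measurableSet_Ioi fun τ hτ =>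
    mul_le_mul' (volume_rearr_absSinc_le hτ) le_rfl)

lemma lintegral_gauss_sq :
    ∫⁻ t in Set.Ioi (0 : ℝ), ENNReal.ofReal (gauss t ^ 2) = ENNReal.ofReal (1 / 2) := by
  have he : ∀ t : ℝ, gauss t ^ 2 = Real.exp (-π * t ^ 2) := by
    intro t
    unfold gauss
    rw [← Real.exp_nat_mul]
    congr 1
    push_cast
    ring
  simp only [he]
  rw [← ofReal_integral_eq_lintegral_ofReal
    (integrable_exp_neg_mul_sq Real.pi_pos).integrableOn
    (Eventually.of_forall fun t => (Real.exp_pos _).le), integral_gaussian_Ioi,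
    div_self Real.pi_ne_zero, Real.sqrt_one]

theorem exists_rearr_crossing : ∃ s₀ : ℝ, 0 < s₀ ∧
    (∀ s, 0 < s → s < s₀ → gauss s₀ ≤ rearr absSinc s ∧ rearr absSinc s ≤ gauss s) ∧
    ∀ s, s₀ < s → gauss s ≤ rearr absSinc s ∧ rearr absSinc s ≤ gauss s₀ := by
  obtain ⟨s₀, h0, hl, hr⟩ := exists_crossing
  have hle : ∀ s, 0 < s → s < s₀ → rearr absSinc s ≤ gauss s := fun s hs hs0 =>
    rearr_le (gauss_pos s) (by rw [distribFn_absSinc]; exact hl s hs hs0)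
  have hge : ∀ s, s₀ < s → gauss s ≤ rearr absSinc s := by
    intro s hs
    refine le_csInf (rearr_absSinc_nonempty s) ?_
    rintro τ ⟨_, hτ⟩
    rw [distribFn_absSinc] at hτ
    by_contra! h
    have hmono : sincDistrib (gauss s) ≤ sincDistrib τ :=
      measure_mono fun t ht => ⟨ht.1, h.trans ht.2⟩
    exact ((hr s hs).trans_le hmono).not_ge hτ
  refine ⟨s₀, h0, fun s hs hs0 => ⟨?_, hle s hs hs0⟩, fun s hs => ⟨hge s hs, ?_⟩⟩
  · refine le_of_tendsto (continuous_gauss.continuousWithinAt (s := Set.Ioi s₀) (x := s₀)).tendsto ?_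
    filter_upwards [self_mem_nhdsWithin] with r hr'
    exact (hge r hr').trans (antitone_rearr_absSinc (hs0.trans hr').le)
  · refine ge_of_tendsto (continuous_gauss.continuousWithinAt (s := Set.Iio s₀) (x := s₀)).tendsto ?_
    filter_upwards [self_mem_nhdsWithin, mem_nhdsWithin_of_mem_nhds (lt_mem_nhds h0)]
      with r hr' hr0
    exact (antitone_rearr_absSinc ((show r < s₀ from hr').trans hs).le).trans (hle r hr0 hr')

/-! ### Comparison of powers -/

lemma rpow_sub_rpow_ge {q c x y : ℝ} (hq : 2 ≤ q) (hc : 0 < c) (hcx : c ≤ x) (hxy : x ≤ y) :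
    q / 2 * c ^ (q - 2) * (y ^ 2 - x ^ 2) ≤ y ^ q - x ^ q := by
  have hm : MonotoneOn (fun z : ℝ => z ^ q - q / 2 * c ^ (q - 2) * z ^ 2) (Set.Ici c) := by
    have hd : ∀ z : ℝ, HasDerivAt (fun z : ℝ => z ^ q - q / 2 * c ^ (q - 2) * z ^ 2)
        (q * z ^ (q - 1) - q / 2 * c ^ (q - 2) * (2 * z)) z := by
      intro z
      have h2 := (hasDerivAt_pow 2 z).const_mul (q / 2 * c ^ (q - 2))
      exact (Real.hasDerivAt_rpow_const (Or.inr (by linarith))).sub (by simpa using h2)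
    refine monotoneOn_of_deriv_nonneg (convex_Ici c)
      (fun z _ => (hd z).continuousAt.continuousWithinAt)
      (fun z _ => (hd z).differentiableAt.differentiableWithinAt) fun z hz => ?_
    rw [interior_Ici, Set.mem_Ioi] at hz
    have hz0 : 0 < z := hc.trans hz
    rw [(hd z).deriv, show q - 1 = q - 2 + 1 by ring, Real.rpow_add_one hz0.ne']
    have : c ^ (q - 2) ≤ z ^ (q - 2) := Real.rpow_le_rpow hc.le hz.le (by linarith)
    have := mul_le_mul_of_nonneg_right this (show 0 ≤ q * z by positivity)
    linarith
  have := hm hcx (hcx.trans hxy) hxy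
  simp only at this
  linarith

lemma rpow_sub_rpow_le {q c x y : ℝ} (hq : 2 ≤ q) (hx : 0 ≤ x) (hxy : x ≤ y) (hyc : y ≤ c) :
    y ^ q - x ^ q ≤ q / 2 * c ^ (q - 2) * (y ^ 2 - x ^ 2) := by
  have hm : AntitoneOn (fun z : ℝ => z ^ q - q / 2 * c ^ (q - 2) * z ^ 2) (Set.Icc 0 c) := by
    have hd : ∀ z : ℝ, HasDerivAt (fun z : ℝ => z ^ q - q / 2 * c ^ (q - 2) * z ^ 2)
        (q * z ^ (q - 1) - q / 2 * c ^ (q - 2) * (2 * z)) z := by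
      intro z
      have h2 := (hasDerivAt_pow 2 z).const_mul (q / 2 * c ^ (q - 2))
      exact (Real.hasDerivAt_rpow_const (Or.inr (by linarith))).sub (by simpa using h2)
    refine antitoneOn_of_deriv_nonpos (convex_Icc 0 c)
      (fun z _ => (hd z).continuousAt.continuousWithinAt)
      (fun z _ => (hd z).differentiableAt.differentiableWithinAt) fun z hz => ?_
    rw [interior_Icc] at hz
    obtain ⟨hz0, hzc⟩ := hz
    rw [(hd z).deriv, show q - 1 = q - 2 + 1 by ring, Real.rpow_add_one hz0.ne']
    have : z ^ (q - 2) ≤ c ^ (q - 2) := Real.rpow_le_rpow hz0.le hzc.le (by linarith)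
    have := mul_le_mul_of_nonneg_right this (show 0 ≤ q * z by positivity)
    linarith
  have := hm ⟨hx, hxy.trans hyc⟩ ⟨hx.trans hxy, hyc⟩ hxy
  simp only at this
  linarith

/-- `L(p,q)` version of Ball's integral inequality: for `2 ≤ q ≤ p < ∞`,
`∫₀^∞ ((sin πt / πt)*)^q t^{q/p−1} dt ≤ ∫₀^∞ e^{−πqt²/2} t^{q/p−1} dt`. -/
theorem statement6 (p q : ℝ) (hq : 2 ≤ q) (hqp : q ≤ p) :
    ∫⁻ t in Set.Ioi (0:ℝ),
        ENNReal.ofReal ((rearr (fun s => |Real.sin (π * s) / (π * s)|) t) ^ q *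
          t ^ (q / p - 1)) ≤
      ∫⁻ t in Set.Ioi (0:ℝ),
        ENNReal.ofReal (Real.exp (-(π * q * t ^ 2) / 2) * t ^ (q / p - 1)) := by
  change ∫⁻ t in Set.Ioi (0:ℝ), ENNReal.ofReal (rearr absSinc t ^ q * t ^ (q / p - 1)) ≤ _
  have hg : ∀ t : ℝ, Real.exp (-(π * q * t ^ 2) / 2) = gauss t ^ q := by
    intro t
    unfold gauss
    rw [← Real.exp_mul]
    congr 1
    ring
  simp only [hg]
  obtain ⟨s₀, h0, hl, hr⟩ := exists_rearr_crossing
  have hα : q / p - 1 ≤ 0 := by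
    rw [sub_nonpos, div_le_one (by linarith)]
    exact hqp
  set α := q / p - 1
  set k := q / 2 * gauss s₀ ^ (q - 2) with hk
  have hk0 : 0 ≤ k := mul_nonneg (by linarith) (Real.rpow_nonneg (gauss_pos _).le _)
  set C := k * s₀ ^ α with hC
  have hC0 : 0 ≤ C := mul_nonneg hk0 (Real.rpow_nonneg h0.le _)
  have hpt : ∀ t, 0 < t → t ≠ s₀ →
      rearr absSinc t ^ q * t ^ α + C * gauss t ^ 2 ≤
        gauss t ^ q * t ^ α + C * rearr absSinc t ^ 2 := by
    intro t ht hts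
    have hw := Real.rpow_nonneg ht.le α
    rcases lt_or_gt_of_ne hts with h | h
    · obtain ⟨h1, h2⟩ := hl t ht h
      have hpow := rpow_sub_rpow_ge hq (gauss_pos s₀) h1 h2
      have hwt : s₀ ^ α ≤ t ^ α := Real.rpow_le_rpow_of_nonpos ht h.le hα
      have hsq : 0 ≤ gauss t ^ 2 - rearr absSinc t ^ 2 :=
        sub_nonneg.2 (pow_le_pow_left₀ (rearr_nonneg _ _) h2 2)
      have e1 := mul_le_mul_of_nonneg_right hpow hw
      have e2 := mul_le_mul_of_nonneg_right hwt (mul_nonneg hk0 hsq)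
      rw [← hk] at e1
      linarith
    · obtain ⟨h1, h2⟩ := hr t h
      have hpow := rpow_sub_rpow_le hq (gauss_pos t).le h1 h2
      have hwt : t ^ α ≤ s₀ ^ α := Real.rpow_le_rpow_of_nonpos h0 h.le hα
      have hsq : 0 ≤ rearr absSinc t ^ 2 - gauss t ^ 2 :=
        sub_nonneg.2 (pow_le_pow_left₀ (gauss_pos t).le h1 2)
      have e1 := mul_le_mul_of_nonneg_right hpow hw
      have e2 := mul_le_mul_of_nonneg_right hwt (mul_nonneg hk0 hsq)
      rw [← hk] at e1
      linarith
  have hadd : ∀ u v : ℝ → ℝ, (∀ t, 0 ≤ u t) → (∀ t, 0 ≤ v t) → Measurable v →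
      ∫⁻ t in Set.Ioi (0:ℝ), ENNReal.ofReal (u t ^ q * t ^ α + C * v t ^ 2) =
        (∫⁻ t in Set.Ioi (0:ℝ), ENNReal.ofReal (u t ^ q * t ^ α)) +
          ENNReal.ofReal C * ∫⁻ t in Set.Ioi (0:ℝ), ENNReal.ofReal (v t ^ 2) := by
    intro u v hu hv hvm
    rw [← lintegral_const_mul _ (hvm.pow_const 2).ennreal_ofReal, ← lintegral_add_right _
      ((hvm.pow_const 2).ennreal_ofReal.const_mul _)]
    refine setLIntegral_congr_fun measurableSet_Ioi fun t ht => ?_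
    rw [ENNReal.ofReal_add (mul_nonneg (Real.rpow_nonneg (hu t) _)
      (Real.rpow_nonneg (le_of_lt ht) _)) (mul_nonneg hC0 (sq_nonneg _)), ENNReal.ofReal_mul hC0]
  have hmain : ∫⁻ t in Set.Ioi (0:ℝ),
        ENNReal.ofReal (rearr absSinc t ^ q * t ^ α + C * gauss t ^ 2) ≤
      ∫⁻ t in Set.Ioi (0:ℝ),
        ENNReal.ofReal (gauss t ^ q * t ^ α + C * rearr absSinc t ^ 2) := by
    refine lintegral_mono_ae ?_
    filter_upwards [ae_restrict_mem measurableSet_Ioi,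
      ae_restrict_of_ae (Measure.ae_ne volume s₀)] with t ht hts
    exact ENNReal.ofReal_le_ofReal (hpt t ht hts)
  rw [hadd _ _ (rearr_nonneg _) (fun t => (gauss_pos t).le) continuous_gauss.measurable,
    hadd _ _ (fun t => (gauss_pos t).le) (rearr_nonneg _) antitone_rearr_absSinc.measurable,
    lintegral_gauss_sq] at hmain
  have hfin : ENNReal.ofReal C * ENNReal.ofReal (1 / 2) ≠ ⊤ :=
    ENNReal.mul_ne_top ENNReal.ofReal_ne_top ENNReal.ofReal_ne_top
  refine (ENNReal.add_le_add_iff_right hfin).1 (hmain.trans ?_)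
  gcongr
  exact lintegral_rearr_absSinc_sq_le
end
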